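/- Let u ∈ S_n and let I, J be subsets of {1,…,n} of equal cardinality. If the minor Δ_{I,J} (the determinant of the square submatrix with row set I and column set J, rows and columns taken in increasing order) is nonzero at some point of Y°_u, then Δ_{I,J}(x) ≠ 0 for every x ∈ Y°_u, and furthermore Δ_{I,J}(x) ≠ 0 for every x ∈ Y_{≥u}. -/

import Mathlib

open scoped Classical

namespace BruhatTNN

abbrev Mat (n : ℕ) := Matrix (Fin n) (Fin n) ℝ

/-- `x` is upper unitriangular. -/
def upperUni {n : ℕ} (x : Mat n) : Prop :=
  (∀ i, x i i = 1) ∧ ∀ i j : Fin n, j < i → x i j = 0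

/-- `x` is lower unitriangular. -/
def lowerUni {n : ℕ} (x : Mat n) : Prop :=
  (∀ i, x i i = 1) ∧ ∀ i j : Fin n, i < j → x i j = 0

/-- `x` is invertible upper triangular (`x ∈ B`). -/
def upperTriInv {n : ℕ} (x : Mat n) : Prop :=
  IsUnit x.det ∧ ∀ i j : Fin n, j < i → x i j = 0

/-- `x` is invertible lower triangular (`x ∈ B_-`). -/
def lowerTriInv {n : ℕ} (x : Mat n) : Prop :=
  IsUnit x.det ∧ ∀ i j : Fin n, i < j → x i j = 0

/-- `x` is invertible diagonal (`x ∈ H`). -/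
def diagInv {n : ℕ} (x : Mat n) : Prop :=
  IsUnit x.det ∧ ∀ i j : Fin n, i ≠ j → x i j = 0

/-- `x` admits a Gaussian decomposition (`x ∈ G_0`). -/
def hasGauss {n : ℕ} (x : Mat n) : Prop :=
  ∃ a d b : Mat n, lowerUni a ∧ diagInv d ∧ upperUni b ∧ x = a * d * b

/-- The factor `[x]_-` of the Gaussian decomposition (junk value `1` if none exists). -/
noncomputable def gaussMinus {n : ℕ} (x : Mat n) : Mat n :=
  if h : hasGauss x then h.choose else 1

/-- The factor `[x]_0` of the Gaussian decomposition (junk value `1` if none exists). -/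
noncomputable def gaussDiag {n : ℕ} (x : Mat n) : Mat n :=
  if h : hasGauss x then h.choose_spec.choose else 1

/-- The factor `[x]_+` of the Gaussian decomposition (junk value `1` if none exists). -/
noncomputable def gaussPlus {n : ℕ} (x : Mat n) : Mat n :=
  if h : hasGauss x then h.choose_spec.choose_spec.choose else 1

/-- The permutation matrix of `w`, with entry `1` in position `(w j, j)`. -/
def permMat {n : ℕ} (w : Equiv.Perm (Fin n)) : Mat n :=
  Matrix.of fun i j => if i = w j then (1 : ℝ) else 0

/-- The minor of `x` with row set `I` and column set `J` (taken in increasing order). -/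
def minorOf {n : ℕ} (x : Mat n) (k : ℕ) (I J : Finset (Fin n))
    (hI : I.card = k) (hJ : J.card = k) : ℝ :=
  Matrix.det (Matrix.of fun a b : Fin k => x (I.orderEmbOfFin hI a) (J.orderEmbOfFin hJ b))

/-- `x` is totally nonnegative: all its minors are nonnegative. -/
def totNonneg {n : ℕ} (x : Mat n) : Prop :=
  ∀ (k : ℕ) (I J : Finset (Fin n)) (hI : I.card = k) (hJ : J.card = k),
    0 ≤ minorOf x k I J hI hJ

/-- The Bruhat order on the symmetric group. -/
def bruhatLE {n : ℕ} (u v : Equiv.Perm (Fin n)) : Prop :=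
  ∀ i j : Fin n,
    (Finset.univ.filter fun k : Fin n => k ≤ i ∧ j ≤ u k).card ≤
    (Finset.univ.filter fun k : Fin n => k ≤ i ∧ j ≤ v k).card

/-- The double coset `B_- w B_-`. -/
def doubleCosetBm {n : ℕ} (w : Equiv.Perm (Fin n)) : Set (Mat n) :=
  {x | ∃ b₁ b₂ : Mat n, lowerTriInv b₁ ∧ lowerTriInv b₂ ∧ x = b₁ * permMat w * b₂}

/-- `N^w = B_- w B_- ∩ N`. -/
def Ncell {n : ℕ} (w : Equiv.Perm (Fin n)) : Set (Mat n) :=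
  {x | upperUni x ∧ x ∈ doubleCosetBm w}

/-- `N_-(w) = w⁻¹ N w ∩ N_-`. -/
def Nminus {n : ℕ} (w : Equiv.Perm (Fin n)) : Set (Mat n) :=
  {x | lowerUni x ∧ ∃ y : Mat n, upperUni y ∧ x = permMat w⁻¹ * y * permMat w}

/-- `N(w) = w⁻¹ N w ∩ N`. -/
def Ngrp {n : ℕ} (w : Equiv.Perm (Fin n)) : Set (Mat n) :=
  {x | upperUni x ∧ ∃ y : Mat n, upperUni y ∧ x = permMat w⁻¹ * y * permMat w}

/-- The totally positive cell `Y°_w = Y ∩ B_- w B_-`. -/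
def Ycirc {n : ℕ} (w : Equiv.Perm (Fin n)) : Set (Mat n) :=
  {x | upperUni x ∧ totNonneg x ∧ x ∈ doubleCosetBm w}

/-- `Y_{≥ u} = ⋃_{v ≥ u} Y°_v`. -/
def Yge {n : ℕ} (u : Equiv.Perm (Fin n)) : Set (Mat n) :=
  {x | ∃ v, bruhatLE u v ∧ x ∈ Ycirc v}

/-- `A = u⁻¹ [x u⁻¹]_+ u`. -/
noncomputable def Amat {n : ℕ} (u : Equiv.Perm (Fin n)) (x : Mat n) : Mat n :=
  permMat u⁻¹ * gaussPlus (x * permMat u⁻¹) * permMat u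

/-- The projection `π_u(x) = [u [u⁻¹ [x u⁻¹]_+ u]_-]_+`. -/
noncomputable def piMap {n : ℕ} (u : Equiv.Perm (Fin n)) (x : Mat n) : Mat n :=
  gaussPlus (permMat u * gaussMinus (Amat u x))

/-- `str(M)`: the sum of the matrix entries immediately above the main diagonal. -/
def strAbove {n : ℕ} (M : Mat n) : ℝ :=
  ∑ p : Fin n × Fin n, if (p.1 : ℕ) + 1 = (p.2 : ℕ) then M p.1 p.2 else 0

/-- The number of inversions (the length) of a permutation. -/
def invNum {n : ℕ} (w : Equiv.Perm (Fin n)) : ℕ :=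
  (Finset.univ.filter fun p : Fin n × Fin n => p.1 < p.2 ∧ w p.2 < w p.1).card

theorem minorOf_nonneg_of_strictMono {n : ℕ} {x : Mat n} (hx : totNonneg x) {k : ℕ}
    {f h : Fin k → Fin n} (hf : StrictMono f) (hh : StrictMono h) :
    0 ≤ (x.submatrix f h).det := by
  have hI : (Finset.univ.image f).card = k := by
    rw [Finset.card_image_of_injective _ hf.injective]; simp
  have hJ : (Finset.univ.image h).card = k := by
    rw [Finset.card_image_of_injective _ hh.injective]; simp
  have h1 := Finset.orderEmbOfFin_unique hI (f := f) (by simp) hf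
  have h2 := Finset.orderEmbOfFin_unique hJ (f := h) (by simp) hh
  have h3 := hx k _ _ hI hJ
  rw [minorOf, ← h1, ← h2] at h3
  exact h3

theorem totNonneg_iff {n : ℕ} {x : Mat n} :
    totNonneg x ↔ ∀ (k : ℕ) (f h : Fin k → Fin n), StrictMono f → StrictMono h →
      0 ≤ (x.submatrix f h).det :=
  ⟨fun hx _ _ _ hf hh => minorOf_nonneg_of_strictMono hx hf hh,
    fun hx k _ _ _ _ => hx k _ _ (OrderEmbedding.strictMono _) (OrderEmbedding.strictMono _)⟩

/-- The rows of `x` together with the signed standard basis vectors `(-1) ^ c • e_c`. -/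
def extRows {n : ℕ} (x : Mat n) : Matrix (Fin n ⊕ Fin n) (Fin n) ℝ :=
  Matrix.of (Sum.elim (fun c => Pi.single c ((-1) ^ (c : ℕ))) x)

theorem extRows_inl {n : ℕ} (x : Mat n) (c : Fin n) :
    extRows x (Sum.inl c) = Pi.single c ((-1) ^ (c : ℕ)) := rfl

theorem extRows_inr {n : ℕ} (x : Mat n) (i : Fin n) : extRows x (Sum.inr i) = x i := rfl

/-- The position of a row of `extRows`: basis vectors in decreasing order, then rows of `x`. -/
def rowPos {n : ℕ} : Fin n ⊕ Fin n → ℝ :=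
  Sum.elim (fun c => -((c : ℕ) : ℝ) - 1) (fun i => ((i : ℕ) : ℝ))

theorem rowPos_injective {n : ℕ} : Function.Injective (rowPos (n := n)) := by
  rintro (a | a) (b | b) hab
  · simp only [rowPos, Sum.elim_inl, sub_left_inj, neg_inj, Nat.cast_inj] at hab
    rw [Fin.ext hab]
  · simp only [rowPos, Sum.elim_inl, Sum.elim_inr] at hab
    have h1 : (0 : ℝ) ≤ ((a : ℕ) : ℝ) := Nat.cast_nonneg _
    have h2 : (0 : ℝ) ≤ ((b : ℕ) : ℝ) := Nat.cast_nonneg _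
    linarith
  · simp only [rowPos, Sum.elim_inl, Sum.elim_inr] at hab
    have h1 : (0 : ℝ) ≤ ((a : ℕ) : ℝ) := Nat.cast_nonneg _
    have h2 : (0 : ℝ) ≤ ((b : ℕ) : ℝ) := Nat.cast_nonneg _
    linarith
  · simp only [rowPos, Sum.elim_inr, Nat.cast_inj] at hab
    rw [Fin.ext hab]

theorem det_extRows_nonneg_of_sorted {n : ℕ} {x : Mat n} (hx : totNonneg x) :
    ∀ (k : ℕ) (f : Fin k → Fin n ⊕ Fin n) (h : Fin k → Fin n), StrictMono (rowPos ∘ f) →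
      StrictMono h →
      (∀ a c, f a = Sum.inl c → ∀ p : Fin n, p ≤ c → ∃ q : Fin k, (q : ℕ) = p ∧ h q = p) →
      0 ≤ ((extRows x).submatrix f h).det := by
  intro k
  induction k with
  | zero => intro f h _ _ _; simp
  | succ k ih =>
    intro f h hf hh hc
    rcases hf0 : f 0 with c | i
    · obtain ⟨q, hq, hqc⟩ := hc 0 c hf0 c le_rfl
      rw [Matrix.det_succ_row_zero, Finset.sum_eq_single q]
      · have hval : (extRows x).submatrix f h 0 q = (-1) ^ (c : ℕ) := by
          simp [extRows_inl, hf0, hqc]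
        rw [hval, hq, ← pow_add, Even.neg_one_pow ⟨_, rfl⟩, one_mul, Matrix.submatrix_submatrix]
        refine ih _ _ (fun a b hab => hf (Fin.succ_lt_succ_iff.2 hab))
          (hh.comp (Fin.strictMono_succAbove q)) ?_
        intro a c' hac p hp
        have hcc : c' < c := by
          have := hf (Fin.succ_pos a)
          simp only [Function.comp_apply] at this hac
          rw [hf0, hac] at this
          simp only [rowPos, Sum.elim_inl, sub_lt_sub_iff_right, neg_lt_neg_iff, Nat.cast_lt] at this
          exact this
        obtain ⟨r, hr, hrp⟩ := hc a.succ c' hac p hp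
        have hpc : (p : ℕ) < c := lt_of_le_of_lt hp hcc
        have hrk : (r : ℕ) < k := by have := q.2; omega
        refine ⟨⟨r, hrk⟩, hr, ?_⟩
        have : q.succAbove ⟨r, hrk⟩ = r := by
          rw [Fin.succAbove_of_castSucc_lt]
          · rfl
          · simp only [Fin.lt_def, Fin.val_castSucc]; omega
        rw [Function.comp_apply, this, hrp]
      · intro b _ hb
        have : h b ≠ c := fun hbc => hb (hh.injective (hbc.trans hqc.symm))
        simp [extRows_inl, hf0, this]
      · simp
    · have hall : ∀ a, ∃ j, f a = Sum.inr j := by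
        intro a
        rcases ha : f a with c | j
        · have := hf.monotone (Fin.zero_le a)
          simp only [Function.comp_apply, hf0, ha, rowPos, Sum.elim_inl, Sum.elim_inr] at this
          have h1 : (0 : ℝ) ≤ ((i : ℕ) : ℝ) := Nat.cast_nonneg _
          have h2 : (0 : ℝ) ≤ ((c : ℕ) : ℝ) := Nat.cast_nonneg _
          linarith
        · exact ⟨j, rfl⟩
      choose g hg using hall
      have : (extRows x).submatrix f h = x.submatrix g h := by
        ext a b; simp [extRows_inr, hg]
      rw [this]
      refine minorOf_nonneg_of_strictMono hx (fun a b hab => ?_) hh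
      have := hf hab
      simp only [Function.comp_apply, hg, rowPos, Sum.elim_inr, Nat.cast_lt] at this
      exact this

/-- The Vandermonde product of the positions of a tuple of rows. -/
noncomputable def posProd {n : ℕ} (v : Fin n → Fin n ⊕ Fin n) : ℝ :=
  ∏ p : Fin n × Fin n with p.1 < p.2, (rowPos (v p.2) - rowPos (v p.1))

theorem posProd_eq_det {n : ℕ} (v : Fin n → Fin n ⊕ Fin n) :
    posProd v = (Matrix.vandermonde (rowPos ∘ v)).det := by
  rw [Matrix.det_vandermonde, posProd, Finset.prod_filter, ← Finset.univ_product_univ,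
    Finset.prod_product]
  refine Finset.prod_congr rfl fun i _ => ?_
  rw [← Finset.prod_filter]
  refine Finset.prod_congr ?_ fun _ _ => rfl
  ext; simp

theorem posProd_mul_det_nonneg {n : ℕ} {x : Mat n} (hx : totNonneg x)
    (v : Fin n → Fin n ⊕ Fin n) : 0 ≤ posProd v * ((extRows x).submatrix v id).det := by
  by_cases hv : Function.Injective v
  · set σ := Tuple.sort (rowPos ∘ v) with hσ
    have hmono : StrictMono (rowPos ∘ (v ∘ σ)) :=
      (Tuple.monotone_sort (rowPos ∘ v)).strictMono_of_injective
        ((rowPos_injective.comp hv).comp σ.injective)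
    have h1 : 0 ≤ ((extRows x).submatrix (v ∘ σ) id).det :=
      det_extRows_nonneg_of_sorted hx n _ _ hmono strictMono_id
        (fun a c _ p _ => ⟨p, rfl, rfl⟩)
    have h2 : 0 ≤ posProd (v ∘ σ) :=
      Finset.prod_nonneg fun p hp => sub_nonneg.2 (hmono (Finset.mem_filter.1 hp).2).le
    have h3 : posProd (v ∘ σ) = (Equiv.Perm.sign σ : ℤ) * posProd v := by
      rw [posProd_eq_det, posProd_eq_det, ← Matrix.det_permute]; rfl
    have h4 : ((extRows x).submatrix (v ∘ σ) id).det =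
        (Equiv.Perm.sign σ : ℤ) * ((extRows x).submatrix v id).det := by
      rw [← Matrix.det_permute]; rfl
    have h5 := mul_nonneg h2 h1
    rw [h3, h4] at h5
    rcases Int.units_eq_one_or (Equiv.Perm.sign σ) with hs | hs <;> simpa [hs] using h5
  · simp only [Function.Injective, not_forall] at hv
    obtain ⟨a, b, hab, hne⟩ := hv
    rw [Matrix.det_zero_of_row_eq hne (by ext j; simp [hab]), mul_zero]

theorem injective_of_det_extRows_ne_zero {n : ℕ} {x : Mat n} {v : Fin n → Fin n ⊕ Fin n}
    (hv : ((extRows x).submatrix v id).det ≠ 0) : Function.Injective v := by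
  intro a b hab
  by_contra hne
  exact hv (Matrix.det_zero_of_row_eq hne (by ext j; simp [hab]))

theorem posProd_mul_det_pos {n : ℕ} {x : Mat n} (hx : totNonneg x) {v : Fin n → Fin n ⊕ Fin n}
    (hv : ((extRows x).submatrix v id).det ≠ 0) :
    0 < posProd v * ((extRows x).submatrix v id).det := by
  refine lt_of_le_of_ne (posProd_mul_det_nonneg hx v) (mul_ne_zero ?_ hv).symm
  rw [posProd_eq_det, Matrix.det_vandermonde_ne_zero_iff]
  exact rowPos_injective.comp (injective_of_det_extRows_ne_zero hv)

theorem posProd_exchange_nonpos {n : ℕ} {v : Fin n → Fin n ⊕ Fin n} {i₁ i₂ : Fin n}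
    (hi : i₂ ≠ i₁) {g m : Fin n ⊕ Fin n}
    (hg : rowPos g < rowPos m) (hm : rowPos m < rowPos (v i₁))
    (hb : rowPos (v i₂) < rowPos g ∨ rowPos (v i₁) < rowPos (v i₂)) :
    posProd v * posProd (Function.update v i₁ g) * posProd (Function.update v i₂ m) *
      posProd (Function.update (Function.update v i₂ m) i₁ g) ≤ 0 := by
  set F : Fin n × Fin n → ℝ := fun p =>
    (rowPos (v p.2) - rowPos (v p.1)) *
    (rowPos (Function.update v i₁ g p.2) - rowPos (Function.update v i₁ g p.1)) *
    (rowPos (Function.update v i₂ m p.2) - rowPos (Function.update v i₂ m p.1)) *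
    (rowPos (Function.update (Function.update v i₂ m) i₁ g p.2) -
      rowPos (Function.update (Function.update v i₂ m) i₁ g p.1)) with hF
  have hneg : F (i₁, i₂) ≤ 0 ∧ F (i₂, i₁) ≤ 0 := by
    have key : ∀ a b c d : ℝ, a < b → b < c → (d < a ∨ c < d) →
        (d - c) * (d - a) * (b - c) * (b - a) ≤ 0 := by
      intro a b c d hab hbc hd
      have h1 : 0 ≤ (d - c) * (d - a) := by
        rcases hd with hd | hd
        · exact mul_nonneg_of_nonpos_of_nonpos (by linarith) (by linarith)
        · exact mul_nonneg (by linarith) (by linarith)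
      have h2 : (b - c) * (b - a) ≤ 0 :=
        mul_nonpos_of_nonpos_of_nonneg (by linarith) (by linarith)
      have := mul_nonpos_of_nonneg_of_nonpos h1 h2
      linarith
    have hk := key _ _ _ _ hg hm hb
    constructor
    · simpa [hF, hi, hi.symm] using hk
    · simp only [hF, Function.update_self, Function.update_of_ne hi, Function.update_of_ne hi.symm]
      linarith
  have hpos : ∀ p : Fin n × Fin n, p.1 ≠ p.2 → p ≠ (i₁, i₂) → p ≠ (i₂, i₁) → 0 ≤ F p := by
    rintro ⟨i, j⟩ hij h1 h2
    simp only [ne_eq, Prod.mk.injEq, not_and] at hij h1 h2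
    have key : ∀ a b : ℝ, 0 ≤ a * b * a * b := fun a b => by nlinarith [sq_nonneg (a * b)]
    have key' : ∀ a b : ℝ, 0 ≤ a * a * b * b := fun a b => by nlinarith [sq_nonneg (a * b)]
    by_cases hi1 : i = i₁
    · subst hi1
      have hj1 : j ≠ i := fun h => hij h.symm
      have hj2 : j ≠ i₂ := h1 rfl
      simp only [hF, Function.update_self, Function.update_of_ne hi.symm,
        Function.update_of_ne hj1, Function.update_of_ne hj2]
      exact key _ _
    · by_cases hj1 : j = i₁
      · subst hj1
        have hi2 : i ≠ i₂ := fun h => h2 h rfl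
        simp only [hF, Function.update_self, Function.update_of_ne hi.symm,
          Function.update_of_ne hi1, Function.update_of_ne hi2]
        exact key _ _
      · simp only [hF, Function.update_of_ne hi1, Function.update_of_ne hj1]
        exact key' _ _
  have hprod : posProd v * posProd (Function.update v i₁ g) * posProd (Function.update v i₂ m) *
      posProd (Function.update (Function.update v i₂ m) i₁ g) =
      ∏ p : Fin n × Fin n with p.1 < p.2, F p := by
    simp only [posProd, hF, Finset.prod_mul_distrib]
  have main : ∀ p₀ : Fin n × Fin n, p₀.1 < p₀.2 → F p₀ ≤ 0 →
      (∀ p : Fin n × Fin n, p.1 < p.2 → p ≠ p₀ → 0 ≤ F p) →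
      ∏ p : Fin n × Fin n with p.1 < p.2, F p ≤ 0 := by
    intro p₀ hp₀ hn hp
    rw [← Finset.mul_prod_erase _ _ (Finset.mem_filter.2 ⟨Finset.mem_univ p₀, hp₀⟩)]
    refine mul_nonpos_of_nonpos_of_nonneg hn (Finset.prod_nonneg fun p hpp => ?_)
    rw [Finset.mem_erase, Finset.mem_filter] at hpp
    exact hp p hpp.2.2 hpp.1
  rw [hprod]
  rcases lt_or_gt_of_ne hi with h | h
  · refine main (i₂, i₁) h hneg.2 fun p hp hne => hpos p hp.ne ?_ hne
    rintro rfl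
    exact absurd hp h.not_gt
  · refine main (i₁, i₂) h hneg.1 fun p hp hne => hpos p hp.ne hne ?_
    rintro rfl
    exact absurd hp h.not_gt

/-- The span of the rows of `extRows x` strictly between `e_q` and the row `m` of `x`. -/
def cornerSpan {n : ℕ} (x : Mat n) (q m : Fin n) : Submodule ℝ (Fin n → ℝ) :=
  Submodule.span ℝ (extRows x '' {l | rowPos (Sum.inl q) < rowPos l ∧ rowPos l < rowPos (Sum.inr m)})

theorem det_extRows_eq_zero_of_update {n : ℕ} {x : Mat n} (hx : totNonneg x) {q m m' : Fin n}
    (hmm : (m' : ℕ) = m + 1) (hm : x m ∉ cornerSpan x q m)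
    (hm' : x m' ∈ cornerSpan x q m ⊔ Submodule.span ℝ {x m})
    (v : Fin n → Fin n ⊕ Fin n) (i₁ : Fin n) (hv : ∀ i, v i ≠ Sum.inr m)
    (hv₁ : v i₁ = Sum.inr m')
    (hz : ((extRows x).submatrix (Function.update v i₁ (Sum.inr m)) id).det = 0) :
    ((extRows x).submatrix v id).det = 0 := by
  by_contra hM
  have hupd : ∀ (w : Fin n → Fin n ⊕ Fin n) i l, (extRows x).submatrix (Function.update w i l) id =
      ((extRows x).submatrix w id).updateRow i (extRows x l) := by
    intro w i l
    ext a b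
    by_cases h : a = i
    · subst h; simp
    · simp [h]
  have hinj : Function.Injective v := injective_of_det_extRows_ne_zero hM
  set M := (extRows x).submatrix v id with hMdef
  have hunit : IsUnit M.det := isUnit_iff_ne_zero.2 hM
  rw [hupd, extRows_inr, ← hMdef] at hz
  obtain ⟨g, hg, hφg⟩ : ∃ g, (rowPos (Sum.inl q) < rowPos g ∧ rowPos g < rowPos (Sum.inr m)) ∧
      (M.updateRow i₁ (extRows x g)).det ≠ 0 := by
    by_contra! hcon
    set φ : (Fin n → ℝ) →ₗ[ℝ] ℝ := Matrix.detRowAlternating.toMultilinearMap.toLinearMap M i₁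
      with hφ
    have hφdef : ∀ y, φ y = (M.updateRow i₁ y).det := fun y => rfl
    have hle : cornerSpan x q m ⊔ Submodule.span ℝ {x m} ≤ LinearMap.ker φ := by
      refine sup_le (Submodule.span_le.2 ?_) (Submodule.span_le.2 ?_)
      · rintro _ ⟨l, hl, rfl⟩
        rw [SetLike.mem_coe, LinearMap.mem_ker, hφdef]
        exact hcon l hl
      · rintro _ rfl
        rw [SetLike.mem_coe, LinearMap.mem_ker, hφdef]
        exact hz
    have := hle hm'
    rw [LinearMap.mem_ker, hφdef] at this
    apply hM
    rw [← this]
    congr 1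
    ext a b
    by_cases h : a = i₁
    · subst h; simp [hMdef, hv₁, extRows_inr]
    · simp [h]
  set c : Fin n → ℝ := Matrix.vecMul (x m) M⁻¹ with hc
  have hxm : x m = ∑ k, c k • M k := by
    have h1 : Matrix.vecMul c M = x m := by
      rw [hc, Matrix.vecMul_vecMul, Matrix.nonsing_inv_mul _ hunit, Matrix.vecMul_one]
    rw [← h1]
    ext j
    simp [Matrix.vecMul, dotProduct]
  have hc₁ : c i₁ = 0 := by
    have h1 := M.det_updateRow_sum i₁ c
    rw [← hxm, hz, smul_eq_mul] at h1
    exact (mul_eq_zero.1 h1.symm).resolve_right hM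
  obtain ⟨i₂, hvi₂, hc₂⟩ : ∃ i₂, ¬ (rowPos (Sum.inl q) < rowPos (v i₂) ∧
      rowPos (v i₂) < rowPos (Sum.inr m)) ∧ c i₂ ≠ 0 := by
    by_contra hcon
    replace hcon : ∀ i, ¬ (rowPos (Sum.inl q) < rowPos (v i) ∧
        rowPos (v i) < rowPos (Sum.inr m)) → c i = 0 :=
      fun i h => by_contra fun h' => hcon ⟨i, h, h'⟩
    refine hm ?_
    rw [hxm]
    refine Submodule.sum_mem _ fun i _ => ?_
    by_cases h : rowPos (Sum.inl q) < rowPos (v i) ∧ rowPos (v i) < rowPos (Sum.inr m)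
    · exact Submodule.smul_mem _ _ (Submodule.subset_span ⟨v i, h, rfl⟩)
    · rw [hcon i h, zero_smul]; exact Submodule.zero_mem _
  have hi : i₂ ≠ i₁ := by rintro rfl; exact hc₂ hc₁
  have hmlt : rowPos (Sum.inr m : Fin n ⊕ Fin n) < rowPos (v i₁) := by
    rw [hv₁]; simp [rowPos, hmm]
  have hb : rowPos (v i₂) < rowPos g ∨ rowPos (v i₁) < rowPos (v i₂) := by
    rw [not_and_or, not_lt, not_lt] at hvi₂
    rcases hvi₂ with h | h
    · exact Or.inl (h.trans_lt hg.1)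
    · right
      have hne : v i₂ ≠ v i₁ := fun h => hi (hinj h)
      rcases hv₂ : v i₂ with d | j
      · rw [hv₂] at h
        simp only [rowPos, Sum.elim_inl, Sum.elim_inr] at h
        have h1 : (0 : ℝ) ≤ ((d : ℕ) : ℝ) := Nat.cast_nonneg _
        have h2 : (0 : ℝ) ≤ ((m : ℕ) : ℝ) := Nat.cast_nonneg _
        linarith
      · rw [hv₂, hv₁] at hne
        have hjm := hv i₂
        rw [hv₂] at hjm h
        simp only [rowPos, Sum.elim_inr, Nat.cast_le] at h
        have h1 : (j : ℕ) ≠ m := fun h => hjm (by rw [Fin.ext h])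
        have h2 : (j : ℕ) ≠ m' := fun h => hne (by rw [Fin.ext h])
        rw [hv₁]
        simp only [rowPos, Sum.elim_inr, Nat.cast_lt]
        omega
  have hsign := posProd_exchange_nonpos hi hg.2 hmlt hb
  have hd₃ : ((extRows x).submatrix (Function.update v i₂ (Sum.inr m)) id).det =
      c i₂ * M.det := by
    rw [hupd, extRows_inr, ← hMdef]
    conv_lhs => rw [hxm]
    rw [Matrix.det_updateRow_sum, smul_eq_mul]
  have hd₄ : ((extRows x).submatrix
      (Function.update (Function.update v i₂ (Sum.inr m)) i₁ g) id).det =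
      c i₂ * (M.updateRow i₁ (extRows x g)).det := by
    rw [Function.update_comm hi, hupd, hupd, extRows_inr, ← hMdef]
    have hxm' : x m = ∑ k, c k • (M.updateRow i₁ (extRows x g)) k := by
      rw [hxm]
      refine Finset.sum_congr rfl fun k _ => ?_
      by_cases h : k = i₁
      · rw [h, hc₁, zero_smul, zero_smul]
      · rw [Matrix.updateRow_ne h]
    conv_lhs => rw [hxm']
    rw [Matrix.det_updateRow_sum, smul_eq_mul]
  have hd₂ : ((extRows x).submatrix (Function.update v i₁ g) id).det =
      (M.updateRow i₁ (extRows x g)).det := by rw [hupd]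
  have e₁ := posProd_mul_det_pos hx hM
  have e₂ := posProd_mul_det_pos hx (hd₂.trans_ne hφg)
  have e₃ := posProd_mul_det_pos hx (hd₃.trans_ne (mul_ne_zero hc₂ hM))
  have e₄ := posProd_mul_det_pos hx (hd₄.trans_ne (mul_ne_zero hc₂ hφg))
  rw [hd₂] at e₂
  rw [hd₃] at e₃
  rw [hd₄] at e₄
  rw [← hMdef] at e₁
  have hpos := mul_pos (mul_pos (mul_pos e₁ e₂) e₃) e₄
  have hsq := mul_nonneg_of_nonpos_of_nonpos hsign
    (neg_nonpos.2 (sq_nonneg (M.det * (M.updateRow i₁ (extRows x g)).det * c i₂)))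
  nlinarith [hpos, hsq]

theorem exists_det_extRows_eq {n k : ℕ} (h : Fin k → Fin n) (hh : Function.Injective h) :
    ∃ (e : {c // c ∉ Set.range h} ⊕ Fin k ≃ Fin n) (d : ℝ), d ≠ 0 ∧ ∀ (x : Mat n)
      (f : Fin k → Fin n),
      ((extRows x).submatrix (Sum.map Subtype.val f ∘ e.symm) id).det =
        d * (x.submatrix f h).det := by
  have hbij : Function.Bijective
      (Sum.elim Subtype.val h : {c // c ∉ Set.range h} ⊕ Fin k → Fin n) := by
    constructor
    · refine Function.Injective.sumElim Subtype.val_injective hh ?_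
      intro a b hab
      exact a.2 ⟨b, hab.symm⟩
    · intro c
      by_cases hc : c ∈ Set.range h
      · obtain ⟨b, rfl⟩ := hc
        exact ⟨Sum.inr b, rfl⟩
      · exact ⟨Sum.inl ⟨c, hc⟩, rfl⟩
  obtain ⟨e, he⟩ : ∃ e : {c // c ∉ Set.range h} ⊕ Fin k ≃ Fin n,
      ∀ i, e i = Sum.elim Subtype.val h i := ⟨Equiv.ofBijective _ hbij, fun _ => rfl⟩
  refine ⟨e, (Matrix.diagonal fun c : {c // c ∉ Set.range h} => (-1 : ℝ) ^ (c.1 : ℕ)).det, ?_, ?_⟩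
  · rw [Matrix.det_diagonal]
    exact Finset.prod_ne_zero_iff.2 fun _ _ => pow_ne_zero _ (by norm_num)
  · intro x f
    have hsub : ((extRows x).submatrix (Sum.map Subtype.val f ∘ e.symm) id).submatrix e e =
        (extRows x).submatrix (Sum.map Subtype.val f) (Sum.elim Subtype.val h) := by
      rw [Matrix.submatrix_submatrix, Function.comp_assoc, Equiv.symm_comp_self, ← funext he]
      rfl
    rw [← Matrix.det_submatrix_equiv_self e, hsub,
      ← Matrix.det_fromBlocks_zero₁₂ _
        (x.submatrix f (Subtype.val : {c // c ∉ Set.range h} → Fin n))]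
    congr 1
    ext (a | a) (b | b)
    · by_cases hab : a = b
      · subst hab; simp [extRows_inl]
      · have : b.1 ≠ a.1 := fun h => hab (Subtype.ext h.symm)
        simp [extRows_inl, hab, this]
    · have : h b ≠ a.1 := fun hb => a.2 ⟨b, hb⟩
      simp [extRows_inl, this]
    · simp [extRows_inr]
    · simp [extRows_inr]

theorem det_submatrix_update_eq_zero {n : ℕ} {x : Mat n} (hx : totNonneg x) {q m m' : Fin n}
    (hmm : (m' : ℕ) = m + 1) (hm : x m ∉ cornerSpan x q m)
    (hm' : x m' ∈ cornerSpan x q m ⊔ Submodule.span ℝ {x m})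
    {k : ℕ} {f h : Fin k → Fin n} (hf : Function.Injective f) (hh : Function.Injective h)
    {a : Fin k} (ha : f a = m) (hz : (x.submatrix f h).det = 0) :
    (x.submatrix (Function.update f a m') h).det = 0 := by
  obtain ⟨e, d, hd, hdet⟩ := exists_det_extRows_eq h hh
  have hne : m ≠ m' := fun h => by rw [h] at hmm; omega
  set v : Fin n → Fin n ⊕ Fin n := Sum.map Subtype.val (Function.update f a m') ∘ e.symm with hv
  have hupd : Function.update v (e (Sum.inr a)) (Sum.inr m) = Sum.map Subtype.val f ∘ e.symm := by
    ext1 i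
    obtain ⟨(i | i), rfl⟩ := e.surjective i
    · have : e (Sum.inl i) ≠ e (Sum.inr a) := fun h => by simpa using e.injective h
      simp [this, hv]
    · by_cases hi : i = a
      · subst hi; simp [ha]
      · have : e (Sum.inr i) ≠ e (Sum.inr a) := fun h => hi (by simpa using e.injective h)
        simp [this, hv, hi]
  have := det_extRows_eq_zero_of_update hx hmm hm hm' v (e (Sum.inr a)) ?_ (by simp [hv]) ?_
  · rw [hdet] at this
    exact (mul_eq_zero.1 this).resolve_left hd
  · intro i
    obtain ⟨(i | i), rfl⟩ := e.surjective i
    · simp [hv]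
    · by_cases hi : i = a
      · subst hi; simp [hv, hne.symm]
      · have : f i ≠ m := fun h => hi (hf (h.trans ha.symm))
        simp [hv, hi, this]
  · rw [hupd, hdet, hz, mul_zero]

/-- Add `t` times the row `m'` to the row `m`. -/
noncomputable def addRow {n : ℕ} (x : Mat n) (m m' : Fin n) (t : ℝ) : Mat n :=
  x.updateRow m (x m + t • x m')

theorem addRow_mul {n : ℕ} (x y : Mat n) (m m' : Fin n) (t : ℝ) :
    addRow x m m' t * y = addRow (x * y) m m' t := by
  rw [addRow, Matrix.updateRow_mul, addRow, Matrix.add_vecMul, Matrix.smul_vecMul]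
  rfl

theorem addRow_addRow {n : ℕ} (x : Mat n) {m m' : Fin n} (hne : m' ≠ m) (s t : ℝ) :
    addRow (addRow x m m' s) m m' t = addRow x m m' (s + t) := by
  simp only [addRow, Matrix.updateRow_self, Matrix.updateRow_ne hne, Matrix.updateRow_idem]
  congr 1
  rw [add_smul, add_assoc]

theorem addRow_zero {n : ℕ} (x : Mat n) (m m' : Fin n) : addRow x m m' 0 = x := by
  simp [addRow]

theorem det_addRow {n : ℕ} (x : Mat n) {m m' : Fin n} (hne : m ≠ m') (t : ℝ) :
    (addRow x m m' t).det = x.det :=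
  Matrix.det_updateRow_add_smul_self x hne t

theorem upperUni_addRow {n : ℕ} {x : Mat n} (hx : upperUni x) {m m' : Fin n} (h : m < m') (t : ℝ) :
    upperUni (addRow x m m' t) := by
  constructor
  · intro i
    by_cases hi : i = m
    · subst hi; simp [addRow, hx.1, hx.2 _ _ h]
    · simp [addRow, hi, hx.1]
  · intro i j hij
    by_cases hi : i = m
    · subst hi; simp [addRow, hx.2 _ _ hij, hx.2 _ _ (hij.trans h)]
    · simp [addRow, hi, hx.2 _ _ hij]

theorem submatrix_addRow_of_notMem {n k : ℕ} (x : Mat n) {m : Fin n} (m' : Fin n) (t : ℝ)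
    {f : Fin k → Fin n} (h : Fin k → Fin n) (hf : ∀ a, f a ≠ m) :
    (addRow x m m' t).submatrix f h = x.submatrix f h := by
  ext a b; simp [addRow, hf a]

theorem det_submatrix_addRow {n k : ℕ} (x : Mat n) {m m' : Fin n} (t : ℝ)
    {f : Fin k → Fin n} (h : Fin k → Fin n) (hf : Function.Injective f) {a : Fin k}
    (ha : f a = m) :
    ((addRow x m m' t).submatrix f h).det =
      (x.submatrix f h).det + t * (x.submatrix (Function.update f a m') h).det := by
  have h1 : (addRow x m m' t).submatrix f h =
      (x.submatrix f h).updateRow a ((x.submatrix f h) a + t • fun b => x m' (h b)) := by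
    ext i j
    by_cases hi : i = a
    · subst hi; simp [addRow, ha]
    · have : f i ≠ m := fun h => hi (hf (h.trans ha.symm))
      simp [addRow, hi, this]
  have h2 : x.submatrix (Function.update f a m') h =
      (x.submatrix f h).updateRow a fun b => x m' (h b) := by
    ext i j
    by_cases hi : i = a
    · subst hi; simp
    · simp [hi]
  rw [h1, h2, Matrix.det_updateRow_add, Matrix.det_updateRow_smul, Matrix.updateRow_eq_self]

theorem strictMono_update {n k : ℕ} {f : Fin k → Fin n} (hf : StrictMono f) {m m' : Fin n}
    (hmm : (m' : ℕ) = m + 1) {a : Fin k} (ha : f a = m) (hm' : ∀ b, f b ≠ m') :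
    StrictMono (Function.update f a m') := by
  intro i j hij
  have h1 := hf hij
  by_cases hi : i = a
  · subst hi
    have h2 := hm' j
    rw [Function.update_self, Function.update_of_ne hij.ne']
    rw [ha] at h1
    rw [ne_eq, Fin.ext_iff] at h2
    rw [Fin.lt_def] at h1 ⊢
    omega
  · by_cases hj : j = a
    · subst hj
      rw [Function.update_self, Function.update_of_ne hi]
      rw [ha] at h1
      rw [Fin.lt_def] at h1 ⊢
      omega
    · rwa [Function.update_of_ne hi, Function.update_of_ne hj]

theorem det_submatrix_update_nonneg {n k : ℕ} {x : Mat n} (hx : totNonneg x) {m m' : Fin n}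
    (hmm : (m' : ℕ) = m + 1) {f h : Fin k → Fin n} (hf : StrictMono f) (hh : StrictMono h)
    {a : Fin k} (ha : f a = m) : 0 ≤ (x.submatrix (Function.update f a m') h).det := by
  by_cases hm' : ∃ b, f b = m'
  · obtain ⟨b, hb⟩ := hm'
    have hba : b ≠ a := by
      rintro rfl
      have : m = m' := ha.symm.trans hb
      rw [this] at hmm; omega
    rw [Matrix.det_zero_of_row_eq hba]
    ext j; simp [hba, hb]
  · exact minorOf_nonneg_of_strictMono hx
      (strictMono_update hf hmm ha fun b hb => hm' ⟨b, hb⟩) hh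

theorem exists_totNonneg_addRow {n : ℕ} {x : Mat n} (hx : totNonneg x) {q m m' : Fin n}
    (hmm : (m' : ℕ) = m + 1) (hm : x m ∉ cornerSpan x q m)
    (hm' : x m' ∈ cornerSpan x q m ⊔ Submodule.span ℝ {x m}) :
    ∃ ε > 0, totNonneg (addRow x m m' (-ε)) := by
  have key : ∀ᶠ ε : ℝ in nhdsWithin 0 (Set.Ioi 0), ∀ (k : Fin (n + 1)) (f h : Fin k → Fin n),
      StrictMono f → StrictMono h → 0 ≤ ((addRow x m m' (-ε)).submatrix f h).det := by
    simp only [Filter.eventually_all]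
    intro k f h hf hh
    by_cases ha : ∃ a, f a = m
    · obtain ⟨a, ha⟩ := ha
      simp only [det_submatrix_addRow x _ h hf.injective ha]
      rcases (minorOf_nonneg_of_strictMono hx hf hh).eq_or_lt with h0 | h0
      · rw [← h0, det_submatrix_update_eq_zero hx hmm hm hm' hf.injective hh.injective ha h0.symm]
        simp
      · have hcont : Continuous fun ε : ℝ => (x.submatrix f h).det +
            -ε * (x.submatrix (Function.update f a m') h).det := by fun_prop
        have h1 := hcont.tendsto 0
        have h2 := (h1.eventually_const_lt (u := 0) (by simpa using h0)).filter_mono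
          (nhdsWithin_le_nhds (s := Set.Ioi 0))
        exact h2.mono fun _ h => h.le
    · push Not at ha
      simp only [submatrix_addRow_of_notMem x m' _ h ha]
      exact Filter.Eventually.of_forall fun _ => minorOf_nonneg_of_strictMono hx hf hh
  obtain ⟨ε, hε, hε'⟩ := (key.and self_mem_nhdsWithin).exists
  refine ⟨ε, hε', totNonneg_iff.2 fun k f h hf hh => ?_⟩
  have hk : k < n + 1 := by
    have := Fintype.card_le_of_injective f hf.injective
    simp only [Fintype.card_fin] at this; omega
  exact hε ⟨k, hk⟩ f h hf hh

theorem lowerTriInv.diag_ne_zero {n : ℕ} {b : Mat n} (hb : lowerTriInv b) (i : Fin n) :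
    b i i ≠ 0 := by
  have h := hb.1.ne_zero
  rw [Matrix.det_of_isLowerTriangular b fun i j hij => hb.2 i j hij] at h
  exact Finset.prod_ne_zero_iff.1 h i (Finset.mem_univ i)

theorem lowerTriInv.inv_apply {n : ℕ} {b : Mat n} (hb : lowerTriInv b) {i j : Fin n} (hij : i < j) :
    b⁻¹ i j = 0 := by
  have := b.invertibleOfIsUnitDet hb.1
  exact Matrix.blockTriangular_inv_of_blockTriangular (M := b) (b := OrderDual.toDual)
    (fun i j hij => hb.2 i j hij) hij

theorem permMat_mul_apply {n : ℕ} (w : Equiv.Perm (Fin n)) (b : Mat n) (i : Fin n) :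
    (permMat w * b) i = b (w.symm i) := by
  ext j
  rw [Matrix.mul_apply, Finset.sum_eq_single (w.symm i)]
  · simp [permMat]
  · intro k _ hk
    have : i ≠ w k := fun h => hk (by simp [h])
    simp [permMat, this]
  · simp

theorem mul_permMat_apply {n : ℕ} (w : Equiv.Perm (Fin n)) (b : Mat n) (i j : Fin n) :
    (b * permMat w) i j = b i (w j) := by
  simp [Matrix.mul_apply, permMat]

theorem mul_apply_eq_sum_smul {n : ℕ} (a b : Mat n) (i : Fin n) :
    (a * b) i = ∑ j, a i j • b j := by
  ext k; simp [Matrix.mul_apply]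

theorem single_mem_cornerSpan {n : ℕ} (x : Mat n) {q c : Fin n} (m : Fin n) (hc : c < q) :
    Pi.single c (1 : ℝ) ∈ cornerSpan x q m := by
  have h : extRows x (Sum.inl c) ∈ cornerSpan x q m := by
    refine Submodule.subset_span ⟨Sum.inl c, ⟨?_, ?_⟩, rfl⟩
    · simpa [rowPos] using hc
    · simp only [rowPos, Sum.elim_inl, Sum.elim_inr]
      have h1 : (0 : ℝ) ≤ ((c : ℕ) : ℝ) := Nat.cast_nonneg _
      have h2 : (0 : ℝ) ≤ ((m : ℕ) : ℝ) := Nat.cast_nonneg _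
      linarith
  have h' := Submodule.smul_mem _ ((-1 : ℝ) ^ (c : ℕ)) h
  rw [extRows_inl, ← Pi.single_smul, smul_eq_mul, ← pow_add, Even.neg_one_pow ⟨_, rfl⟩] at h'
  exact h'

theorem row_mem_cornerSpan {n : ℕ} (x : Mat n) (q : Fin n) {i m : Fin n} (hi : i < m) :
    x i ∈ cornerSpan x q m := by
  refine Submodule.subset_span ⟨Sum.inr i, ⟨?_, ?_⟩, rfl⟩
  · simp only [rowPos, Sum.elim_inl, Sum.elim_inr]
    have h1 : (0 : ℝ) ≤ ((q : ℕ) : ℝ) := Nat.cast_nonneg _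
    have h2 : (0 : ℝ) ≤ ((i : ℕ) : ℝ) := Nat.cast_nonneg _
    linarith
  · simpa [rowPos] using hi

theorem cornerSpan_le {n : ℕ} {x : Mat n} {q m : Fin n} {S : Submodule ℝ (Fin n → ℝ)}
    (h1 : ∀ c < q, Pi.single c (1 : ℝ) ∈ S) (h2 : ∀ i < m, x i ∈ S) : cornerSpan x q m ≤ S := by
  refine Submodule.span_le.2 ?_
  rintro _ ⟨c | i, ⟨hl, hr⟩, rfl⟩
  · have hc : c < q := by simpa [rowPos] using hl
    have h := S.smul_mem ((-1 : ℝ) ^ (c : ℕ)) (h1 c hc)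
    rw [← Pi.single_smul, smul_eq_mul, mul_one] at h
    exact h
  · exact h2 i (by simpa [rowPos] using hr)

theorem cornerSpan_addRow {n : ℕ} (x : Mat n) (q m m' : Fin n) (t : ℝ) :
    cornerSpan (addRow x m m' t) q m = cornerSpan x q m := by
  refine le_antisymm (cornerSpan_le (fun c hc => single_mem_cornerSpan x m hc) fun i hi => ?_)
    (cornerSpan_le (fun c hc => single_mem_cornerSpan _ m hc) fun i hi => ?_)
  · rw [addRow, Matrix.updateRow_ne hi.ne]
    exact row_mem_cornerSpan x q hi
  · have := row_mem_cornerSpan (addRow x m m' t) q hi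
    rwa [addRow, Matrix.updateRow_ne hi.ne] at this

theorem row_notMem_cornerSpan {n : ℕ} {b₁ b₂ : Mat n} (h₁ : lowerTriInv b₁) (h₂ : lowerTriInv b₂)
    (w : Equiv.Perm (Fin n)) (m : Fin n) :
    (b₁ * permMat w * b₂) m ∉ cornerSpan (b₁ * permMat w * b₂) (w.symm m) m := by
  set x := b₁ * permMat w * b₂ with hx
  set ψ : (Fin n → ℝ) →ₗ[ℝ] ℝ := LinearMap.proj (w.symm m) ∘ₗ Matrix.vecMulLinear b₂⁻¹ with hψ
  have hψx : ∀ i, ψ (x i) = b₁ i m := by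
    intro i
    have : ψ (x i) = (x * b₂⁻¹) i (w.symm m) := rfl
    rw [this, hx, Matrix.mul_nonsing_inv_cancel_right _ _ h₂.1, mul_permMat_apply,
      Equiv.apply_symm_apply]
  have hle : cornerSpan x (w.symm m) m ≤ LinearMap.ker ψ := by
    refine cornerSpan_le (fun c hc => ?_) (fun i hi => ?_)
    · rw [LinearMap.mem_ker]
      have : ψ (Pi.single c 1) = b₂⁻¹ c (w.symm m) := by simp [hψ]
      rw [this, h₂.inv_apply hc]
    · rw [LinearMap.mem_ker, hψx, h₁.2 i m hi]
  intro hmem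
  have := hle hmem
  rw [LinearMap.mem_ker, hψx] at this
  exact h₁.diag_ne_zero m this

theorem row_sub_mem_cornerSpan {n : ℕ} {b₁ b₂ : Mat n} (h₁ : lowerTriInv b₁) (h₂ : lowerTriInv b₂)
    (w : Equiv.Perm (Fin n)) {m m' : Fin n} (hmm : (m' : ℕ) = m + 1)
    (hw : w.symm m' < w.symm m) :
    (b₁ * permMat w * b₂) m' - (b₁ m' m / b₁ m m) • (b₁ * permMat w * b₂) m ∈
      cornerSpan (b₁ * permMat w * b₂) (w.symm m) m := by
  set y := permMat w * b₂ with hy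
  set x := b₁ * permMat w * b₂ with hx
  have hxy : x = b₁ * y := by rw [hx, hy, Matrix.mul_assoc]
  have hyx : y = b₁⁻¹ * x := by rw [hxy, Matrix.nonsing_inv_mul_cancel_left _ _ h₁.1]
  rw [hxy, mul_apply_eq_sum_smul, mul_apply_eq_sum_smul, Finset.smul_sum, ← Finset.sum_sub_distrib,
    ← hxy]
  refine Submodule.sum_mem _ fun j _ => ?_
  rw [smul_smul, ← sub_smul]
  rcases lt_trichotomy j m with hj | hj | hj
  · refine Submodule.smul_mem _ _ ?_
    rw [hyx, mul_apply_eq_sum_smul]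
    refine Submodule.sum_mem _ fun i _ => ?_
    rcases le_or_gt i j with hi | hi
    · exact Submodule.smul_mem _ _ (row_mem_cornerSpan x _ (hi.trans_lt hj))
    · rw [h₁.inv_apply hi, zero_smul]; exact Submodule.zero_mem _
  · rw [hj, div_mul_cancel₀ _ (h₁.diag_ne_zero m), sub_self, zero_smul]
    exact Submodule.zero_mem _
  · by_cases hj' : j = m'
    · refine Submodule.smul_mem _ _ ?_
      rw [hj', hy, permMat_mul_apply, pi_eq_sum_univ' (b₂ (w.symm m'))]
      refine Submodule.sum_mem _ fun c _ => ?_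
      rcases lt_or_ge c (w.symm m) with hc | hc
      · have := Submodule.smul_mem _ (b₂ (w.symm m') c) (single_mem_cornerSpan x m hc)
        convert this using 2
      · rw [h₂.2 _ _ (hw.trans_le hc), zero_smul]; exact Submodule.zero_mem _
    · have hlt : m' < j := by
        rw [Fin.lt_def] at hj ⊢
        have : (j : ℕ) ≠ m' := fun h => hj' (Fin.ext h)
        omega
      rw [h₁.2 _ _ hlt, h₁.2 _ _ hj, mul_zero, sub_zero, zero_smul]
      exact Submodule.zero_mem _

theorem exists_totNonneg_addRow_of_ne {n : ℕ} {b₁ b₂ : Mat n} (h₁ : lowerTriInv b₁)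
    (h₂ : lowerTriInv b₂) (w : Equiv.Perm (Fin n)) {m m' : Fin n} (hmm : (m' : ℕ) = m + 1)
    (hw : w.symm m' < w.symm m) {t : ℝ}
    (ht : totNonneg (addRow (b₁ * permMat w * b₂) m m' (-t)))
    (hne : 1 - t * (b₁ m' m / b₁ m m) ≠ 0) :
    ∃ ε > 0, totNonneg (addRow (b₁ * permMat w * b₂) m m' (-(t + ε))) := by
  have hmne : m' ≠ m := fun h => by rw [h] at hmm; omega
  have hnot := row_notMem_cornerSpan h₁ h₂ w m
  have hsub := row_sub_mem_cornerSpan h₁ h₂ w hmm hw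
  set x := b₁ * permMat w * b₂
  set ρ := b₁ m' m / b₁ m m
  set S := cornerSpan x (w.symm m) m with hS
  have hx'm : addRow x m m' (-t) m = x m - t • x m' := by
    simp [addRow, sub_eq_add_neg]
  have hx'm' : addRow x m m' (-t) m' = x m' := by simp [addRow, hmne]
  obtain ⟨ε, hε, hpos⟩ := exists_totNonneg_addRow ht (q := w.symm m) hmm
    (by
      rw [cornerSpan_addRow, hx'm]
      intro hmem
      apply hnot
      have : x m = (1 - t * ρ)⁻¹ • ((x m - t • x m') + t • (x m' - ρ • x m)) := by
        rw [eq_inv_smul_iff₀ hne]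
        module
      rw [this]
      exact S.smul_mem _ (S.add_mem hmem (S.smul_mem _ hsub)))
    (by
      rw [cornerSpan_addRow, hx'm, hx'm']
      have : x m' = (1 - t * ρ)⁻¹ • (x m' - ρ • x m) + ((1 - t * ρ)⁻¹ * ρ) • (x m - t • x m') := by
        rw [mul_smul, ← smul_add, eq_inv_smul_iff₀ hne]
        module
      have hmem := Submodule.add_mem_sup (S.smul_mem (1 - t * ρ)⁻¹ hsub) (Submodule.smul_mem _
        ((1 - t * ρ)⁻¹ * ρ) (Submodule.mem_span_singleton_self (R := ℝ) (x m - t • x m')))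
      rwa [← this] at hmem)
  refine ⟨ε, hε, ?_⟩
  rwa [addRow_addRow x hmne, ← neg_add] at hpos

theorem permMat_mul_permMat {n : ℕ} (σ τ : Equiv.Perm (Fin n)) :
    permMat σ * permMat τ = permMat (σ * τ) := by
  ext i j
  rw [mul_permMat_apply]
  rfl

theorem permMat_one {n : ℕ} : permMat (1 : Equiv.Perm (Fin n)) = 1 := by
  ext i j
  by_cases h : i = j <;> simp [permMat, Matrix.one_apply, h]

theorem addRow_mem_doubleCosetBm {n : ℕ} {b₁ b₂ : Mat n} (h₁ : lowerTriInv b₁)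
    (h₂ : lowerTriInv b₂) (w : Equiv.Perm (Fin n)) {m m' : Fin n} (hmm : (m' : ℕ) = m + 1) {t : ℝ}
    (ht : b₁ m m = t * b₁ m' m) :
    addRow (b₁ * permMat w * b₂) m m' (-t) ∈ doubleCosetBm (Equiv.swap m m' * w) := by
  have hlt : m < m' := by rw [Fin.lt_def]; omega
  have hswap : permMat (Equiv.swap m m') * permMat (Equiv.swap m m') = 1 := by
    rw [permMat_mul_permMat, Equiv.swap_mul_self, permMat_one]
  refine ⟨addRow b₁ m m' (-t) * permMat (Equiv.swap m m'), b₂, ⟨?_, ?_⟩, h₂, ?_⟩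
  · rw [Matrix.det_mul, det_addRow _ hlt.ne]
    exact h₁.1.mul (Matrix.isUnit_det_of_right_inverse hswap)
  · intro i j hij
    rw [mul_permMat_apply]
    by_cases hi : i = m
    · subst hi
      by_cases hj : j = m'
      · subst hj; simp [addRow, ht]
      · have hj' : m' < j := by
          rw [Fin.lt_def] at hij ⊢
          rw [Fin.ext_iff] at hj
          omega
        rw [Equiv.swap_apply_of_ne_of_ne hij.ne' hj]
        simp [addRow, h₁.2 _ _ hij, h₁.2 _ _ hj']
    · rw [addRow, Matrix.updateRow_ne hi]
      refine h₁.2 _ _ ?_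
      by_cases hj : j = m
      · subst hj; rw [Equiv.swap_apply_left]; exact hij.trans hlt
      · by_cases hj' : j = m'
        · subst hj'
          rw [Equiv.swap_apply_right]
          rw [Fin.lt_def] at hij ⊢
          rw [Fin.ext_iff] at hi
          omega
        · rwa [Equiv.swap_apply_of_ne_of_ne hj hj']
  · rw [← addRow_mul, ← addRow_mul, ← permMat_mul_permMat, ← Matrix.mul_assoc,
      Matrix.mul_assoc (addRow b₁ m m' (-t)) (permMat (Equiv.swap m m')), hswap, Matrix.mul_one]

theorem exists_mem_Ycirc_addRow {n : ℕ} {w : Equiv.Perm (Fin n)} {x : Mat n} (hx : x ∈ Ycirc w)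
    {m m' : Fin n} (hmm : (m' : ℕ) = m + 1) (hw : w.symm m' < w.symm m) :
    ∃ t > 0, ∃ x' ∈ Ycirc (Equiv.swap m m' * w), x = addRow x' m m' t := by
  obtain ⟨hU, hT, b₁, b₂, h₁, h₂, hxb⟩ := hx
  have hlt : m < m' := by rw [Fin.lt_def]; omega
  set T : Set ℝ := {t | 0 ≤ t ∧ totNonneg (addRow x m m' (-t))} with hTdef
  have hclosed : IsClosed T := by
    have hcont : ∀ (k : ℕ) (f h : Fin k → Fin n),
        Continuous fun t : ℝ => ((addRow x m m' (-t)).submatrix f h).det := by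
      intro k f h
      refine Continuous.matrix_det (Continuous.matrix_submatrix ?_ f h)
      simp only [addRow]
      fun_prop
    simp only [hTdef, totNonneg_iff, Set.ofPred_and, Set.ofPred_forall]
    refine (isClosed_le continuous_const continuous_id).inter ?_
    refine isClosed_iInter fun k => isClosed_iInter fun f => isClosed_iInter fun h =>
      isClosed_iInter fun _ => isClosed_iInter fun _ => ?_
    exact isClosed_le continuous_const (hcont k f h)
  have hbdd : T ⊆ Set.Icc 0 (x m m') := by
    rintro t ⟨ht0, ht⟩
    refine ⟨ht0, ?_⟩
    have h := minorOf_nonneg_of_strictMono ht (k := 1) (f := fun _ => m) (h := fun _ => m')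
      (Subsingleton.strictMono _) (Subsingleton.strictMono _)
    simp only [addRow, Matrix.det_unique, Matrix.submatrix_apply, Matrix.updateRow_self,
      Pi.add_apply, Pi.smul_apply, smul_eq_mul, hU.1 m'] at h
    linarith
  have hne : T.Nonempty := ⟨0, le_rfl, by rwa [neg_zero, addRow_zero]⟩
  obtain ⟨t, ⟨ht0, ht⟩, htmax⟩ := (isCompact_Icc.of_isClosed_subset hclosed hbdd).exists_isGreatest hne
  have hstep : ∀ s, 0 ≤ s → totNonneg (addRow x m m' (-s)) →
      1 - s * (b₁ m' m / b₁ m m) ≠ 0 → s < t := by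
    intro s hs hsx hne
    rw [hxb] at hsx
    obtain ⟨ε, hε, hpos⟩ := exists_totNonneg_addRow_of_ne h₁ h₂ w hmm hw hsx hne
    rw [← hxb] at hpos
    have := htmax ⟨by linarith, hpos⟩
    linarith
  have htpos : 0 < t := hstep 0 le_rfl (by rwa [neg_zero, addRow_zero]) (by simp)
  have hteq : 1 - t * (b₁ m' m / b₁ m m) = 0 := by
    by_contra hne
    exact lt_irrefl _ (hstep t ht0 ht hne)
  refine ⟨t, htpos, addRow x m m' (-t), ⟨upperUni_addRow hU hlt _, ht, ?_⟩, ?_⟩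
  · rw [hxb]
    refine addRow_mem_doubleCosetBm h₁ h₂ w hmm ?_
    have := h₁.diag_ne_zero m
    field_simp at hteq
    linarith
  · rw [addRow_addRow x hlt.ne', neg_add_cancel, addRow_zero]

theorem card_filter_le_eq {n : ℕ} (w : Equiv.Perm (Fin n)) (i j : Fin n) :
    (Finset.univ.filter fun k : Fin n => k ≤ i ∧ j ≤ w k).card =
      (Finset.univ.filter fun k : Fin n => k ≤ i ∧ j < w k).card +
        if w.symm j ≤ i then 1 else 0 := by
  have h : (if w.symm j ≤ i then 1 else 0) =
      ∑ k, if k = w.symm j then (if k ≤ i then 1 else 0) else 0 := by simp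
  rw [Finset.card_filter, Finset.card_filter, h, ← Finset.sum_add_distrib]
  refine Finset.sum_congr rfl fun k _ => ?_
  by_cases hk : k = w.symm j
  · subst hk; simp
  · have hne : j ≠ w k := fun h => hk (by simp [h])
    simp [hk, hne.le_iff_lt]

theorem card_filter_lt_mono {n : ℕ} {u v : Equiv.Perm (Fin n)} (huv : bruhatLE u v) (i j : Fin n) :
    (Finset.univ.filter fun k : Fin n => k ≤ i ∧ j < u k).card ≤
      (Finset.univ.filter fun k : Fin n => k ≤ i ∧ j < v k).card := by
  by_cases hj : (j : ℕ) + 1 < n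
  · exact huv i ⟨j + 1, hj⟩
  · have hempty : (Finset.univ.filter fun k : Fin n => k ≤ i ∧ j < u k) = ∅ := by
      refine Finset.filter_eq_empty_iff.2 fun k _ h => ?_
      have := Fin.lt_def.1 h.2
      have := (u k).2
      omega
    simp [hempty]

theorem le_swap_apply_iff {n : ℕ} {m m' : Fin n} (hmm : (m' : ℕ) = m + 1) {j : Fin n} (hj : j ≠ m')
    (x : Fin n) : j ≤ Equiv.swap m m' x ↔ j ≤ x := by
  rw [ne_eq, Fin.ext_iff] at hj
  simp only [Fin.le_def]
  by_cases h1 : x = m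
  · subst h1; rw [Equiv.swap_apply_left]; omega
  · by_cases h2 : x = m'
    · subst h2; rw [Equiv.swap_apply_right]; omega
    · rw [Equiv.swap_apply_of_ne_of_ne h1 h2]

theorem lt_swap_apply_iff {n : ℕ} {m m' : Fin n} (hmm : (m' : ℕ) = m + 1) (x : Fin n) :
    m' < Equiv.swap m m' x ↔ m' < x := by
  simp only [Fin.lt_def]
  by_cases h1 : x = m
  · subst h1; rw [Equiv.swap_apply_left]; omega
  · by_cases h2 : x = m'
    · subst h2; rw [Equiv.swap_apply_right]; omega
    · rw [Equiv.swap_apply_of_ne_of_ne h1 h2]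

theorem card_filter_le_left {n : ℕ} {m m' : Fin n} (hmm : (m' : ℕ) = m + 1)
    (w : Equiv.Perm (Fin n)) (i : Fin n) :
    (Finset.univ.filter fun k : Fin n => k ≤ i ∧ m ≤ w k).card =
      (Finset.univ.filter fun k : Fin n => k ≤ i ∧ m' < w k).card +
        (if w.symm m' ≤ i then 1 else 0) + if w.symm m ≤ i then 1 else 0 := by
  rw [card_filter_le_eq, ← card_filter_le_eq w i m']
  congr 3
  ext k
  rw [Fin.lt_def, Fin.le_def (a := m'), hmm]
  rfl

theorem card_filter_swap_mul {n : ℕ} {m m' : Fin n} (hmm : (m' : ℕ) = m + 1)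
    (w : Equiv.Perm (Fin n)) (i : Fin n) :
    (Finset.univ.filter fun k : Fin n => k ≤ i ∧ m' ≤ (Equiv.swap m m' * w) k).card =
      (Finset.univ.filter fun k : Fin n => k ≤ i ∧ m' < w k).card +
        if w.symm m ≤ i then 1 else 0 := by
  have h : (Equiv.swap m m' * w).symm m' = w.symm m := by
    rw [Equiv.symm_apply_eq]; simp
  rw [card_filter_le_eq, h]
  simp only [Equiv.Perm.mul_apply, lt_swap_apply_iff hmm]

theorem bruhatLE.swap_mul_right {n : ℕ} {u v : Equiv.Perm (Fin n)} (huv : bruhatLE u v)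
    {m m' : Fin n} (hmm : (m' : ℕ) = m + 1) (hv : v.symm m' < v.symm m)
    (hu : u.symm m < u.symm m') : bruhatLE u (Equiv.swap m m' * v) := by
  intro i j
  by_cases hj : j = m'
  · subst hj
    have h1 := huv i m
    rw [card_filter_le_left hmm, card_filter_le_left hmm] at h1
    have h2 := card_filter_lt_mono huv i j
    rw [card_filter_swap_mul hmm, card_filter_le_eq]
    rw [Fin.lt_def] at hv hu
    simp only [Fin.le_def] at h1 h2 ⊢
    split_ifs at h1 ⊢ <;> omega
  · simp only [Equiv.Perm.mul_apply, le_swap_apply_iff hmm hj]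
    exact huv i j

theorem bruhatLE.swap_mul {n : ℕ} {u v : Equiv.Perm (Fin n)} (huv : bruhatLE u v)
    {m m' : Fin n} (hmm : (m' : ℕ) = m + 1) (hv : v.symm m' < v.symm m)
    (hu : u.symm m' < u.symm m) : bruhatLE (Equiv.swap m m' * u) (Equiv.swap m m' * v) := by
  intro i j
  by_cases hj : j = m'
  · subst hj
    have h1 := huv i m
    rw [card_filter_le_left hmm, card_filter_le_left hmm] at h1
    have h2 := card_filter_lt_mono huv i j
    rw [card_filter_swap_mul hmm, card_filter_swap_mul hmm]
    rw [Fin.lt_def] at hv hu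
    simp only [Fin.le_def] at h1 h2 ⊢
    split_ifs at h1 ⊢ <;> omega
  · simp only [Equiv.Perm.mul_apply, le_swap_apply_iff hmm hj]
    exact huv i j

/-- A statistic on permutations that decreases when a descent of the inverse is removed. -/
def invWeight {n : ℕ} (w : Equiv.Perm (Fin n)) : ℕ :=
  ∑ i : Fin n, (n - 1 - (i : ℕ)) * (w.symm i : ℕ)

theorem invWeight_swap_mul_lt {n : ℕ} {v : Equiv.Perm (Fin n)} {m m' : Fin n}
    (hmm : (m' : ℕ) = m + 1) (hv : v.symm m' < v.symm m) :
    invWeight (Equiv.swap m m' * v) < invWeight v := by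
  have hne : m ≠ m' := fun h => by rw [h] at hmm; omega
  have hs : ∀ i, (Equiv.swap m m' * v).symm i = v.symm (Equiv.swap m m' i) := by
    intro i; rw [Equiv.symm_apply_eq]; simp
  have hsplit : ∀ g : Fin n → ℕ, ∑ i, g i = g m + (g m' + ∑ i ∈ (Finset.univ.erase m).erase m', g i) :=
    fun g => by
      rw [Finset.add_sum_erase _ _ (by simp [hne.symm]), Finset.add_sum_erase _ _ (Finset.mem_univ m)]
  have hrest : ∑ i ∈ (Finset.univ.erase m).erase m',
      (n - 1 - (i : ℕ)) * (v.symm (Equiv.swap m m' i) : ℕ) =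
      ∑ i ∈ (Finset.univ.erase m).erase m', (n - 1 - (i : ℕ)) * (v.symm i : ℕ) := by
    refine Finset.sum_congr rfl fun i hi => ?_
    rw [Finset.mem_erase, Finset.mem_erase] at hi
    rw [Equiv.swap_apply_of_ne_of_ne hi.2.1 hi.1]
  simp only [invWeight, hs]
  rw [hsplit, hsplit fun i => (n - 1 - (i : ℕ)) * (v.symm i : ℕ), hrest, Equiv.swap_apply_left,
    Equiv.swap_apply_right]
  have hm' := m'.2
  obtain ⟨d, hd⟩ : ∃ d, n - 1 - (m : ℕ) = d + 1 := ⟨n - 1 - m - 1, by omega⟩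
  have hd' : n - 1 - (m' : ℕ) = d := by omega
  rw [Fin.lt_def] at hv
  rw [hd, hd']
  nlinarith

theorem exists_descent_of_ne_one {n : ℕ} {v : Equiv.Perm (Fin n)} (hv : v ≠ 1) :
    ∃ m m' : Fin n, (m' : ℕ) = m + 1 ∧ v.symm m' < v.symm m := by
  by_contra! hcon
  apply hv
  obtain _ | n := n
  · exact Subsingleton.elim _ _
  have hmono : StrictMono v.symm := Fin.strictMono_iff_lt_succ.2 fun i =>
    lt_of_le_of_ne (hcon i.castSucc i.succ (by simp)) fun h =>
      (Fin.castSucc_lt_succ (i := i)).ne (v.symm.injective h)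
  have hmono' : StrictMono v := fun a b hab => by
    rw [← hmono.lt_iff_lt]; simpa
  ext i
  have h1 := hmono.le_apply (x := v i)
  have h2 := hmono'.le_apply (x := i)
  rw [Equiv.symm_apply_apply] at h1
  rw [le_antisymm h1 h2]
  rfl

theorem eq_one_of_bruhatLE_one {n : ℕ} {u : Equiv.Perm (Fin n)} (hu : bruhatLE u 1) : u = 1 := by
  have hle : ∀ k, u k ≤ k := by
    intro k
    by_contra! hk
    have h := hu k (u k)
    have h0 : (Finset.univ.filter fun l : Fin n => l ≤ k ∧ u k ≤ (1 : Equiv.Perm (Fin n)) l) = ∅ :=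
      Finset.filter_eq_empty_iff.2 fun l _ hl => (hk.trans_le (hl.2.trans hl.1)).false
    rw [h0, Finset.card_empty, Nat.le_zero, Finset.card_eq_zero, Finset.filter_eq_empty_iff] at h
    exact h (Finset.mem_univ k) ⟨le_rfl, le_rfl⟩
  have hsum : ∑ k, (u k : ℕ) = ∑ k : Fin n, (k : ℕ) := Equiv.sum_comp u fun k => (k : ℕ)
  ext k
  exact (Finset.sum_eq_sum_iff_of_le fun k _ => Fin.le_def.1 (hle k)).1 hsum k (Finset.mem_univ k)

theorem eq_one_of_mem_Ycirc_one {n : ℕ} {x : Mat n} (hx : x ∈ Ycirc 1) : x = 1 := by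
  obtain ⟨hU, -, b₁, b₂, h₁, h₂, hxb⟩ := hx
  rw [permMat_one, Matrix.mul_one] at hxb
  ext i j
  rcases lt_trichotomy i j with hij | hij | hij
  · rw [Matrix.one_apply_ne hij.ne, hxb, Matrix.mul_apply]
    refine Finset.sum_eq_zero fun k _ => ?_
    rcases lt_or_ge i k with hk | hk
    · rw [h₁.2 _ _ hk, zero_mul]
    · rw [h₂.2 _ _ (hk.trans_lt hij), mul_zero]
  · rw [hij, hU.1, Matrix.one_apply_eq]
  · rw [hU.2 _ _ hij, Matrix.one_apply_ne hij.ne']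

theorem det_submatrix_ne_zero_of_bruhatLE {n : ℕ} (v : Equiv.Perm (Fin n)) :
    ∀ ⦃u : Equiv.Perm (Fin n)⦄ ⦃x y : Mat n⦄, bruhatLE u v → x ∈ Ycirc u → y ∈ Ycirc v →
      ∀ ⦃k : ℕ⦄ ⦃f h : Fin k → Fin n⦄, StrictMono f → StrictMono h →
        (x.submatrix f h).det ≠ 0 → (y.submatrix f h).det ≠ 0 := by
  induction hN : invWeight v using Nat.strong_induction_on generalizing v with
  | _ N ih =>
  subst hN
  intro u x y huv hx hy k f h hf hh hdet
  by_cases hv1 : v = 1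
  · subst hv1
    have hu1 := eq_one_of_bruhatLE_one huv
    subst hu1
    rwa [eq_one_of_mem_Ycirc_one hy, ← eq_one_of_mem_Ycirc_one hx]
  obtain ⟨m, m', hmm, hv⟩ := exists_descent_of_ne_one hv1
  have hne : m' ≠ m := fun h => by rw [h] at hmm; omega
  obtain ⟨t, ht, y', hy', rfl⟩ := exists_mem_Ycirc_addRow hy hmm hv
  specialize ih _ (invWeight_swap_mul_lt hmm hv) _ rfl
  have hnn : 0 ≤ (y'.submatrix f h).det := minorOf_nonneg_of_strictMono hy'.2.1 hf hh
  rcases lt_or_gt_of_ne (u.symm.injective.ne hne) with hu | hu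
  · obtain ⟨s, hs, x', hx', rfl⟩ := exists_mem_Ycirc_addRow hx hmm hu
    have hle := huv.swap_mul hmm hv hu
    by_cases ha : ∃ a, f a = m
    · obtain ⟨a, ha⟩ := ha
      have hnn' := det_submatrix_update_nonneg hy'.2.1 hmm hf hh ha
      rw [det_submatrix_addRow _ _ _ hf.injective ha] at hdet ⊢
      by_cases h0 : (x'.submatrix f h).det = 0
      · have h1 : (x'.submatrix (Function.update f a m') h).det ≠ 0 := fun h1 => by
          simp [h0, h1] at hdet
        have hm' : ∀ b, f b ≠ m' := by
          intro b hb
          have hba : b ≠ a := by rintro rfl; exact hne (hb.symm.trans ha)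
          refine h1 (Matrix.det_zero_of_row_eq hba ?_)
          ext j; simp [hba, hb]
        have h2 := ih hle hx' hy' (strictMono_update hf hmm ha hm') hh h1
        have := mul_pos ht (lt_of_le_of_ne hnn' h2.symm)
        linarith
      · have h2 := lt_of_le_of_ne hnn (ih hle hx' hy' hf hh h0).symm
        have := mul_nonneg ht.le hnn'
        linarith
    · push Not at ha
      rw [submatrix_addRow_of_notMem _ _ _ _ ha] at hdet ⊢
      exact ih hle hx' hy' hf hh hdet
  · have h2 := ih (huv.swap_mul_right hmm hv hu) hx hy' hf hh hdet
    by_cases ha : ∃ a, f a = m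
    · obtain ⟨a, ha⟩ := ha
      have hnn' := det_submatrix_update_nonneg hy'.2.1 hmm hf hh ha
      rw [det_submatrix_addRow _ _ _ hf.injective ha]
      have := lt_of_le_of_ne hnn h2.symm
      have := mul_nonneg ht.le hnn'
      linarith
    · push Not at ha
      rwa [submatrix_addRow_of_notMem _ _ _ _ ha]

theorem statement5 (n : ℕ) (hn : 1 ≤ n) (u : Equiv.Perm (Fin n)) (k : ℕ)
    (I J : Finset (Fin n)) (hI : I.card = k) (hJ : J.card = k)
    (hex : ∃ x ∈ Ycirc u, minorOf x k I J hI hJ ≠ 0) :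
    (∀ x ∈ Ycirc u, minorOf x k I J hI hJ ≠ 0) ∧
    (∀ x ∈ Yge u, minorOf x k I J hI hJ ≠ 0) := by
  obtain ⟨x, hx, hdet⟩ := hex
  have key : ∀ y ∈ Yge u, minorOf y k I J hI hJ ≠ 0 := by
    rintro y ⟨v, huv, hy⟩
    exact det_submatrix_ne_zero_of_bruhatLE v huv hx hy (OrderEmbedding.strictMono _)
      (OrderEmbedding.strictMono _) hdet
  exact ⟨fun y hy => key y ⟨u, fun _ _ => le_rfl, hy⟩, key⟩

end BruhatTNN
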